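/- Let R be a Noetherian commutative ring, m ⊆ R a maximal ideal, and M an R-module. Then for all j, the local cohomology H^j_m(M) is canonically isomorphic to H^j_{m R^∧}(M ⊗_R R^∧), where R^∧ is the m-adic completion of R (insensitivity of local cohomology to completion at a maximal ideal). -/

import Mathlib

open CategoryTheory TensorProduct

universe u

section helpers
open Limits Opposite


namespace LCaux

section generic

theorem chase5 {C : Type*} [Category* C] {A B A' B' A'' B'' A₃ B₃ : C} {x : A ⟶ B} {p : B ⟶ B'}
    {q : A ⟶ A'} {y : A' ⟶ B'} {p' : B' ⟶ B''} {q' : A' ⟶ A''} {z : A'' ⟶ B''}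
    {p'' : B'' ⟶ B₃} {q'' : A'' ⟶ A₃} {w : A₃ ⟶ B₃}
    (h1 : x ≫ p = q ≫ y) (h2 : y ≫ p' = q' ≫ z) (h3 : q'' ≫ w = z ≫ p'') :
    x ≫ (p ≫ p' ≫ p'') = (q ≫ q' ≫ q'') ≫ w := by
  rw [reassoc_of% h1, reassoc_of% h2, Category.assoc, Category.assoc, h3]

theorem chase2 {C : Type*} [Category* C] {A B A' B' B'' A'' : C} {x : A ⟶ B} {p : B ⟶ B'}
    {q : A ⟶ A'} {y : A' ⟶ B'} {p' : B' ⟶ B''} {q' : A' ⟶ A''} {z : A'' ⟶ B''}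
    (h1 : x ≫ p = q ≫ y) (h2 : y ≫ p' = q' ≫ z) :
    x ≫ (p ≫ p') = (q ≫ q') ≫ z := by
  rw [reassoc_of% h1, h2, Category.assoc]

theorem isIso_conj {C : Type*} [Category* C] {A B A' B' : C} (a : A ≅ A') (b : B ≅ B')
    (g : A' ⟶ B') (hg : IsIso g) : IsIso (a.hom ≫ g ≫ b.inv) := inferInstance

theorem isIso_of_conj {C : Type*} [Category* C] {A B A' B' : C} (a : A ≅ A') (b : B ≅ B')
    (g : A' ⟶ B') (f : A ⟶ B) (h : f ≫ b.hom = a.hom ≫ g) (hf : IsIso f) : IsIso g := by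
  have : g = a.inv ≫ f ≫ b.hom := by rw [h]; simp
  rw [this]; infer_instance

theorem isIso_comp' {C : Type*} [Category* C] {A B D : C} (f : A ⟶ B) (g : B ⟶ D)
    (hf : IsIso f) (hg : IsIso g) : IsIso (f ≫ g) := inferInstance

theorem conj_eq {C : Type*} [Category* C] {A B A' B' : C} (a : A ≅ A') (b : B ≅ B')
    (f : A ⟶ B) (g : A' ⟶ B') (h : f = a.hom ≫ g ≫ b.inv) : f ≫ b.hom = a.hom ≫ g := by
  rw [h]; simp

variable {C D E E' : Type*} [Category* C] [Category* D] [Category* E] [Category* E']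
  [Abelian C] [Abelian D] [Abelian E] [Abelian E']
  [EnoughProjectives C] [EnoughProjectives D]

theorem mapHomology_naturality (H : E ⥤ E') [H.Additive] [H.PreservesHomology]
    {K L : ChainComplex E ℕ} (φ : K ⟶ L) (n : ℕ) :
    H.map (HomologicalComplex.homologyMap φ n) ≫ ((L.sc n).mapHomologyIso H).inv =
      ((K.sc n).mapHomologyIso H).inv ≫
        HomologicalComplex.homologyMap ((H.mapHomologicalComplex _).map φ) n :=
  ShortComplex.mapHomologyIso_inv_naturality
    ((HomologicalComplex.shortComplexFunctor E _ n).map φ) H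

noncomputable def derivedCompObj (F : C ⥤ D) [F.Additive] [F.PreservesProjectiveObjects]
    [F.PreservesHomology] (G : D ⥤ E) [G.Additive] (H : E ⥤ E') [H.Additive]
    [H.PreservesHomology] (n : ℕ) {X : C} (P : ProjectiveResolution X) :
    (F ⋙ G.leftDerived n ⋙ H).obj X ≅ ((F ⋙ G ⋙ H).leftDerived n).obj X :=
  H.mapIso ((F.mapProjectiveResolution P).isoLeftDerivedObj G n) ≪≫
    (((((G.mapHomologicalComplex _).obj
      (F.mapProjectiveResolution P).complex).sc n).mapHomologyIso H).symm) ≪≫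
    (P.isoLeftDerivedObj (F ⋙ G ⋙ H) n).symm

theorem derivedCompObj_naturality (F : C ⥤ D) [F.Additive] [F.PreservesProjectiveObjects]
    [F.PreservesHomology] (G : D ⥤ E) [G.Additive] (H : E ⥤ E') [H.Additive]
    [H.PreservesHomology] (n : ℕ) {X Y : C} (f : X ⟶ Y) (P : ProjectiveResolution X)
    (Q : ProjectiveResolution Y) :
    (F ⋙ G.leftDerived n ⋙ H).map f ≫ (derivedCompObj F G H n Q).hom =
      (derivedCompObj F G H n P).hom ≫ ((F ⋙ G ⋙ H).leftDerived n).map f := by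
  let φ : P.complex ⟶ Q.complex := ProjectiveResolution.lift f P Q
  have hφ : φ.f 0 ≫ Q.π.f 0 = P.π.f 0 ≫ f := by
    exact ProjectiveResolution.lift_commutes_zero f P Q
  have hφ' : ((F.mapHomologicalComplex _).map φ).f 0 ≫ (F.mapProjectiveResolution Q).π.f 0
      = (F.mapProjectiveResolution P).π.f 0 ≫ F.map f := by
    have h1 : (F.mapHomologicalComplex _).map φ ≫ (F.mapProjectiveResolution Q).π =
        (F.mapProjectiveResolution P).π ≫ (ChainComplex.single₀ D).map (F.map f) := by
      have e := congrArg (fun t => (F.mapHomologicalComplex (ComplexShape.down ℕ)).map t)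
        (ProjectiveResolution.lift_commutes f P Q)
      simp only [Functor.map_comp] at e
      exact chase2 e ((HomologicalComplex.singleMapHomologicalComplex F
        (ComplexShape.down ℕ) 0).hom.naturality f)
    have h2 := congrArg (fun t => t.f 0) h1
    refine h2.trans ?_
    refine congrArg (fun t => (F.mapProjectiveResolution P).π.f 0 ≫ t) ?_
    exact ChainComplex.single₀_map_f_zero (F.map f)
  have h1 := ProjectiveResolution.isoLeftDerivedObj_hom_naturality (F.map f)
    (F.mapProjectiveResolution P) (F.mapProjectiveResolution Q)
    ((F.mapHomologicalComplex _).map φ) hφ' G n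
  have h2 := ProjectiveResolution.isoLeftDerivedObj_inv_naturality f P Q φ hφ (F ⋙ G ⋙ H) n
  have h3 := mapHomology_naturality H ((G.mapHomologicalComplex _).map
    ((F.mapHomologicalComplex _).map φ)) n
  have h1' := congrArg (fun t => H.map t) h1
  simp only [Functor.map_comp] at h1'
  change H.map ((G.leftDerived n).map (F.map f)) ≫ (H.map _ ≫ _ ≫ _) =
    (H.map _ ≫ _ ≫ (P.isoLeftDerivedObj (F ⋙ G ⋙ H) n).inv) ≫ _
  exact chase5 h1' h3 h2

noncomputable def derivedComp (F : C ⥤ D) [F.Additive] [F.PreservesProjectiveObjects]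
    [F.PreservesHomology] (G : D ⥤ E) [G.Additive] (H : E ⥤ E') [H.Additive]
    [H.PreservesHomology] (n : ℕ) :
    F ⋙ G.leftDerived n ⋙ H ≅ (F ⋙ G ⋙ H).leftDerived n :=
  NatIso.ofComponents (fun X => derivedCompObj F G H n (projectiveResolution X))
    (fun f => derivedCompObj_naturality F G H n f _ _)

noncomputable def derivedCongr {F G : C ⥤ D} [F.Additive] [G.Additive] (e : F ≅ G) (n : ℕ) :
    F.leftDerived n ≅ G.leftDerived n where
  hom := NatTrans.leftDerived e.hom n
  inv := NatTrans.leftDerived e.inv n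
  hom_inv_id := by rw [← NatTrans.leftDerived_comp, e.hom_inv_id, NatTrans.leftDerived_id]
  inv_hom_id := by rw [← NatTrans.leftDerived_comp, e.inv_hom_id, NatTrans.leftDerived_id]

theorem op_preservesHomology (T : E ⥤ E') [T.Additive] [PreservesFiniteLimits T]
    [PreservesFiniteColimits T] : T.op.PreservesHomology := by
  have := preservesFiniteLimits_op T
  have := preservesFiniteColimits_op T
  infer_instance

/-- Abstract core. -/
theorem homologyMap_natTrans {T U : E ⥤ E} [T.Additive] [T.PreservesHomology]
    [U.Additive] [U.PreservesHomology] (τ : T ⟶ U)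
    (K : ChainComplex E ℕ) (n : ℕ) :
    τ.app (K.homology n) ≫ ((K.sc n).mapHomologyIso U).symm.hom =
      ((K.sc n).mapHomologyIso T).symm.hom ≫ HomologicalComplex.homologyMap
      ((NatTrans.mapHomologicalComplex τ (ComplexShape.down ℕ)).app K) n :=
  conj_eq _ _ _ _ (NatTrans.app_homology τ (K.sc n))

theorem isIso_leftDerived_app {G G' : C ⥤ E} [G.Additive] [G'.Additive] (α : G' ⟶ G)
    (T : E ⥤ E) [T.Additive] [T.PreservesHomology] (τ : T ⟶ 𝟭 E)
    (β : G' ⟶ G ⋙ T) (hβ : ∀ X, α.app X = β.app X ≫ τ.app (G.obj X))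
    {X : C} (P : ProjectiveResolution X) (hP : ∀ i, IsIso (β.app (P.complex.X i))) (n : ℕ)
    (hτ : IsIso (τ.app ((G.leftDerived n).obj X))) :
    IsIso ((NatTrans.leftDerived α n).app X) := by
  rw [ProjectiveResolution.leftDerived_app_eq α P]
  let K := (G.mapHomologicalComplex (ComplexShape.down ℕ)).obj P.complex
  let L := (G'.mapHomologicalComplex (ComplexShape.down ℕ)).obj P.complex
  let TK := (T.mapHomologicalComplex (ComplexShape.down ℕ)).obj K
  let b : L ⟶ TK := (NatTrans.mapHomologicalComplex β (ComplexShape.down ℕ)).app P.complex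
  let t : TK ⟶ K := (NatTrans.mapHomologicalComplex τ (ComplexShape.down ℕ)).app K
  have h1 : (NatTrans.mapHomologicalComplex α (ComplexShape.down ℕ)).app P.complex = b ≫ t := by
    ext i
    exact hβ _
  have h2 : IsIso b := by
    have : ∀ i, IsIso (b.f i) := hP
    exact HomologicalComplex.Hom.isIso_of_components _
  have h3 : IsIso (τ.app (K.homology n)) :=
    isIso_of_conj (T.mapIso (P.isoLeftDerivedObj G n)) (P.isoLeftDerivedObj G n) _ _
      (τ.naturality (P.isoLeftDerivedObj G n).hom).symm hτ
  have h4 : IsIso (HomologicalComplex.homologyMap t n) :=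
    isIso_of_conj _ _ _ _ (homologyMap_natTrans τ K n) h3
  refine isIso_conj _ _ _ ?_
  rw [h1]
  change IsIso (HomologicalComplex.homologyMap (b ≫ t) n)
  rw [HomologicalComplex.homologyMap_comp]
  infer_instance

theorem isZero_chase {C : Type*} [Category* C] [HasZeroMorphisms C] {A B A' B' : C}
    (a : A ≅ A') (b : B ≅ B')
    (g : A' ⟶ B') (f : A ⟶ B) (h : f ≫ b.hom = a.hom ≫ g) : f = 0 ↔ g = 0 := by
  constructor
  · rintro rfl
    rw [zero_comp] at h
    rw [← cancel_epi a.hom, ← h, comp_zero]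
  · rintro rfl
    rw [comp_zero] at h
    rw [← cancel_mono b.hom, h, zero_comp]

/-- scalars -/
theorem leftDerived_scalar (G : C ⥤ E) [G.Additive] (τ : 𝟭 E ⟶ 𝟭 E) (σ : 𝟭 C ⟶ 𝟭 C)
    (h : ∀ X, G.map (σ.app X) = τ.app (G.obj X)) (n : ℕ) (X : C) (hX : σ.app X = 0) :
    τ.app ((G.leftDerived n).obj X) = 0 := by
  let P := projectiveResolution X
  let K := (G.mapHomologicalComplex (ComplexShape.down ℕ)).obj P.complex
  have h0 : (G.leftDerived n).map (σ.app X) = 0 := by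
    rw [hX]
    have h2 := ProjectiveResolution.isoLeftDerivedObj_hom_naturality (0 : X ⟶ X) P P 0
      (zero_comp.trans comp_zero.symm) G n
    refine (isZero_chase _ _ _ _ h2).2 ?_
    exact Functor.map_zero _ _ _
  let φ : P.complex ⟶ P.complex :=
    (NatTrans.mapHomologicalComplex σ (ComplexShape.down ℕ)).app P.complex
  have hφ : φ.f 0 ≫ P.π.f 0 = P.π.f 0 ≫ σ.app X :=
    (σ.naturality (P.π.f 0)).symm
  have h2 := ProjectiveResolution.isoLeftDerivedObj_hom_naturality (σ.app X) P P φ hφ G n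
  have h3 : (G.mapHomologicalComplex (ComplexShape.down ℕ)).map φ =
     (NatTrans.mapHomologicalComplex τ (ComplexShape.down ℕ)).app K := by
    ext i
    exact h _
  have h4 : HomologicalComplex.homologyMap ((G.mapHomologicalComplex (ComplexShape.down ℕ)).map φ) n
    = 0 := (isZero_chase _ _ _ _ h2).1 h0
  rw [h3] at h4
  have h5 : τ.app (K.homology n) = 0 := (isZero_chase _ _ _ _ (homologyMap_natTrans τ K n)).2 h4
  exact (isZero_chase (P.isoLeftDerivedObj G n) (P.isoLeftDerivedObj G n) _ _
    (τ.naturality (P.isoLeftDerivedObj G n).hom).symm).2 h5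

end generic
end LCaux

namespace LCaux
variable {R S : Type u} [CommRing R] [CommRing S] (f : R →+* S)

instance extAdditive : (ModuleCat.extendScalars.{u,u,u} f).Additive :=
  (ModuleCat.extendRestrictScalarsAdj f).left_adjoint_additive

instance extProj : (ModuleCat.extendScalars.{u,u,u} f).PreservesProjectiveObjects where
  projective_obj {X} hX := (ModuleCat.extendRestrictScalarsAdj f).map_projective X hX

theorem extHomology (hf : f.Flat) : (ModuleCat.extendScalars.{u,u,u} f).PreservesHomology := by
  have := ModuleCat.preservesFiniteLimits_extendScalars_of_flat hf
  have : PreservesFiniteColimits (ModuleCat.extendScalars.{u,u,u} f) := inferInstance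
  infer_instance

theorem resHomology : (ModuleCat.restrictScalars.{u,u,u} f).op.PreservesHomology := by
  have : PreservesFiniteLimits (ModuleCat.restrictScalars.{u,u,u} f) := inferInstance
  have : PreservesFiniteColimits (ModuleCat.restrictScalars.{u,u,u} f) := inferInstance
  exact op_preservesHomology _

/-- Adjunction as an R-linear equivalence. -/
noncomputable def adjLin (X : ModuleCat.{u} R) (N : ModuleCat.{u} S) :
    (ModuleCat.restrictScalars f).obj (ModuleCat.of S ((ModuleCat.extendScalars f).obj X ⟶ N)) ≃ₗ[R]
     (X ⟶ (ModuleCat.restrictScalars f).obj N) :=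
  { (ModuleCat.extendRestrictScalarsAdj f).homAddEquiv X N with
    map_smul' := by
      intro r x
      apply ModuleCat.hom_ext
      apply LinearMap.ext
      intro y
      rfl }

noncomputable def adjNat' (N : ModuleCat.{u} S) :
    ((linearYoneda R (ModuleCat R)).obj ((ModuleCat.restrictScalars f).obj N)).rightOp ≅
    ModuleCat.extendScalars f ⋙ ((linearYoneda S (ModuleCat S)).obj N).rightOp ⋙
      (ModuleCat.restrictScalars f).op :=
  NatIso.ofComponents (fun X => (adjLin f X N).toModuleIso.op) (by
    intro X Y g
    apply Quiver.Hom.unop_inj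
    apply ModuleCat.hom_ext
    apply LinearMap.ext
    intro h
    exact (ModuleCat.extendRestrictScalarsAdj f).homEquiv_naturality_left g h)

noncomputable def extBC (hf : f.Flat) (N : ModuleCat.{u} S) (n : ℕ) :
    ModuleCat.extendScalars f ⋙ ((linearYoneda S (ModuleCat S)).obj N).rightOp.leftDerived n ⋙
      (ModuleCat.restrictScalars f).op ≅
    ((linearYoneda R (ModuleCat R)).obj ((ModuleCat.restrictScalars f).obj N)).rightOp.leftDerived n :=
  haveI := extHomology f hf
  haveI := resHomology f
  derivedComp (ModuleCat.extendScalars f) ((linearYoneda S (ModuleCat S)).obj N).rightOp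
      (ModuleCat.restrictScalars f).op n ≪≫ derivedCongr (adjNat' f N).symm n
end LCaux

namespace LCaux
section quot
variable {R S : Type u} [CommRing R] [CommRing S] (f : R →+* S) {J : Ideal R} {K : Ideal S}
  (hK : K = J.map f)

noncomputable def qPhi (hK : K = J.map f) : ModuleCat.of R (R ⧸ J) ⟶
    (ModuleCat.restrictScalars f).obj (ModuleCat.of S (S ⧸ K)) :=
  (ModuleCat.ofHom (Y := (ModuleCat.restrictScalars f).obj (ModuleCat.of S (S ⧸ K)))
      { toFun := Ideal.quotientMap K f (hK ▸ Ideal.le_comap_map)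
        map_add' := map_add _
        map_smul' := by
          intro r x
          obtain ⟨x, rfl⟩ := Ideal.Quotient.mk_surjective x
          change Ideal.quotientMap K f _ (Ideal.Quotient.mk _ (r * x)) = f r • Ideal.quotientMap K f (hK ▸ Ideal.le_comap_map) (Ideal.Quotient.mk _ x)
          simp [Algebra.smul_def] })

noncomputable abbrev uu (X : ModuleCat.{u} R) (x : X) : (ModuleCat.extendScalars f).obj X :=
  ((ModuleCat.extendRestrictScalarsAdj f).unit.app X).hom x

theorem uu_zero (X : ModuleCat.{u} R) : uu f X 0 = 0 :=
  map_zero ((ModuleCat.extendRestrictScalarsAdj f).unit.app X).hom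

theorem uu_smul (X : ModuleCat.{u} R) (r : R) (x : X) : uu f X (r • x) = f r • uu f X x :=
  map_smul ((ModuleCat.extendRestrictScalarsAdj f).unit.app X).hom r x

noncomputable def qHom : (ModuleCat.extendScalars f).obj (ModuleCat.of R (R ⧸ J)) ⟶
    ModuleCat.of S (S ⧸ K) :=
  ((ModuleCat.extendRestrictScalarsAdj f).homEquiv _ _).symm (qPhi f hK)

theorem qHom_uu (x : R ⧸ J) : (qHom f hK).hom (uu f (ModuleCat.of R (R ⧸ J)) x) =
    (qPhi f hK).hom x := by
  have := (ModuleCat.extendRestrictScalarsAdj f).homEquiv_unit (X := ModuleCat.of R (R ⧸ J)) (f := qHom f hK)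
  have h2 := Equiv.apply_symm_apply ((ModuleCat.extendRestrictScalarsAdj f).homEquiv _ _) (qPhi f hK)
  have h3 := this.symm.trans h2
  exact congrArg (fun g => g.hom x) h3

noncomputable def qLin (J : Ideal R) : S →ₗ[S] (ModuleCat.extendScalars f).obj (ModuleCat.of R (R ⧸ J)) :=
  LinearMap.toSpanSingleton S _ (uu f (ModuleCat.of R (R ⧸ J)) (Ideal.Quotient.mk J 1))

theorem qLin_f (r : R) : qLin f J (f r) = uu f (ModuleCat.of R (R ⧸ J)) (Ideal.Quotient.mk J r) := by
  refine (uu_smul f (ModuleCat.of R (R ⧸ J)) r (Ideal.Quotient.mk J 1)).symm.trans ?_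
  congr 1
  change Ideal.Quotient.mk J (r * 1) = _
  rw [mul_one]

theorem qLin_ker (hK : K = J.map f) : K ≤ LinearMap.ker (qLin f J) := by
  subst hK
  refine Ideal.map_le_iff_le_comap.2 ?_
  intro r hr
  change qLin f J (f r) = 0
  rw [qLin_f, Ideal.Quotient.eq_zero_iff_mem.2 hr]
  exact uu_zero f _

def qLift (Z : ModuleCat.{u} S) (K : Ideal S) (l : S →ₗ[S] Z) (h : K ≤ LinearMap.ker l) :
    ModuleCat.of S (S ⧸ K) ⟶ Z :=
  ModuleCat.ofHom (Submodule.liftQ K l h)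

noncomputable def qInv (hK : K = J.map f) : ModuleCat.of S (S ⧸ K) ⟶
    (ModuleCat.extendScalars f).obj (ModuleCat.of R (R ⧸ J)) :=
  qLift _ K (qLin f J) (qLin_ker f hK)

theorem qInv_mk (s : S) : (qInv f hK).hom (Ideal.Quotient.mk K s) = qLin f J s := rfl

theorem ext_uu {X : ModuleCat.{u} R} {N : ModuleCat.{u} S} (a b : (ModuleCat.extendScalars f).obj X ⟶ N)
    (h : ∀ x, a.hom (uu f X x) = b.hom (uu f X x)) : a = b :=
  ModuleCat.ExtendScalars.hom_ext h

noncomputable def qIso : (ModuleCat.extendScalars f).obj (ModuleCat.of R (R ⧸ J)) ≅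
    ModuleCat.of S (S ⧸ K) where
  hom := qHom f hK
  inv := qInv f hK
  hom_inv_id := by
    apply ext_uu
    intro x
    change (qInv f hK).hom ((qHom f hK).hom (uu f _ x)) = uu f _ x
    rw [qHom_uu]
    obtain ⟨x, rfl⟩ := Ideal.Quotient.mk_surjective x
    exact qLin_f f x
  inv_hom_id := by
    apply ModuleCat.hom_ext
    apply Submodule.linearMap_qext
    apply LinearMap.ext_ring
    change (qHom f hK).hom ((qInv f hK).hom (Ideal.Quotient.mk K 1)) = Ideal.Quotient.mk K 1
    rw [qInv_mk, ← map_one f, qLin_f, qHom_uu]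
    rfl

theorem qIso_nat {J' : Ideal R} {K' : Ideal S} (hK' : K' = J'.map f) (h : J ≤ J') (h' : K ≤ K') :
    (ModuleCat.extendScalars f).map (ModuleCat.ofHom (Submodule.mapQ J J' LinearMap.id h)) ≫
      (qIso f hK').hom = (qIso f hK).hom ≫ ModuleCat.ofHom (Submodule.mapQ K K' LinearMap.id h') := by
  apply ext_uu
  intro x
  change (qHom f hK').hom (uu f _ (Submodule.mapQ J J' LinearMap.id h x)) = Submodule.mapQ K K' LinearMap.id h' ((qHom f hK).hom (uu f _ x))
  rw [qHom_uu, qHom_uu]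
  obtain ⟨x, rfl⟩ := Ideal.Quotient.mk_surjective x
  rfl

end quot
end LCaux

namespace LCaux
section fg
variable {R : Type u} [CommRing R] [IsNoetherianRing R]

theorem fg_projective (P : FGModuleCat.{u} R)
    (h : Projective ((forget₂ (FGModuleCat.{u} R) (ModuleCat.{u} R)).obj P)) : Projective P where
  factors {E X} f e he := by
    have : Epi ((forget₂ (FGModuleCat.{u} R) (ModuleCat.{u} R)).map e) := inferInstance
    obtain ⟨g, hg⟩ := h.factors ((forget₂ (FGModuleCat.{u} R) (ModuleCat.{u} R)).map f)
      ((forget₂ (FGModuleCat.{u} R) (ModuleCat.{u} R)).map e)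
    refine ⟨(forget₂ (FGModuleCat.{u} R) (ModuleCat.{u} R)).preimage g, ?_⟩
    apply (forget₂ (FGModuleCat.{u} R) (ModuleCat.{u} R)).map_injective
    rw [Functor.map_comp, Functor.map_preimage, hg]

theorem fg_cover (M : FGModuleCat.{u} R) : ∃ (n : ℕ) (p : FGModuleCat.of R (Fin n → R) ⟶ M), Epi p := by
  obtain ⟨n, p, hp⟩ := Module.Finite.exists_fin' R M
  refine ⟨n, FGModuleCat.ofHom p, ?_⟩
  apply (forget₂ (FGModuleCat.{u} R) (ModuleCat.{u} R)).epi_of_epi_map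
  rw [ModuleCat.epi_iff_surjective]
  exact hp

theorem free_proj (n : ℕ) : Projective ((forget₂ (FGModuleCat.{u} R) (ModuleCat.{u} R)).obj
    (FGModuleCat.of R (Fin n → R))) := by
  change Projective (ModuleCat.of R (Fin n → R))
  infer_instance

instance fgEnough : EnoughProjectives (FGModuleCat.{u} R) where
  presentation M := by
    obtain ⟨n, p, hp⟩ := fg_cover M
    exact ⟨{ p := FGModuleCat.of R (Fin n → R), projective := fg_projective _ (free_proj n), f := p, epi := hp }⟩

instance fgPres : (forget₂ (FGModuleCat.{u} R) (ModuleCat.{u} R)).PreservesProjectiveObjects where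
  projective_obj {X} hX := by
    obtain ⟨n, p, hp⟩ := fg_cover X
    have := free_proj (R := R) n
    obtain ⟨s, hs⟩ := hX.factors (𝟙 X) p
    exact Retract.projective (Y := (forget₂ (FGModuleCat.{u} R) (ModuleCat.{u} R)).obj
    (FGModuleCat.of R (Fin n → R))) ((Retract.mk s p hs).map (forget₂ (FGModuleCat.{u} R) (ModuleCat.{u} R)))

theorem fg_resolution (X : Type u) [AddCommGroup X] [Module R X] [Module.Finite R X] :
    ∃ P : ProjectiveResolution (ModuleCat.of R X), ∀ i, Module.Finite R (P.complex.X i) := by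
  let P := ProjectiveResolution.of (FGModuleCat.of R X)
  exact ⟨(forget₂ (FGModuleCat.{u} R) (ModuleCat.{u} R)).mapProjectiveResolution P, fun i => 
     (P.complex.X i).2⟩

end fg
end LCaux

namespace LCaux
section tens
variable (R S : Type u) [CommRing R] [CommRing S] [Algebra R S]

abbrev TT : ModuleCat.{u} R ⥤ ModuleCat.{u} R := MonoidalCategory.tensorLeft (ModuleCat.of R S)

noncomputable def eta : 𝟭 (ModuleCat.{u} R) ⟶ TT R S where
  app X := ModuleCat.ofHom (TensorProduct.mk R S X 1)

noncomputable def betaApp (M X : ModuleCat.{u} R) :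
    S ⊗[R] (X ⟶ M) →ₗ[R] (X ⟶ (TT R S).obj M) :=
  (ModuleCat.homLinearEquiv (S := R)).symm.toLinearMap ∘ₗ
    (TensorProduct.lTensorHomToHomLTensor (.id R) X S M) ∘ₗ
    (LinearMap.lTensor S (ModuleCat.homLinearEquiv (S := R)).toLinearMap)

theorem betaApp_bij (M X : ModuleCat.{u} R) [Projective X] [Module.Finite R X] :
    Function.Bijective (betaApp R S M X) := by
  have e : Function.Bijective (TensorProduct.lTensorHomToHomLTensor (.id R) X S M) := by
    rw [← lTensorHomEquivHomLTensor_toLinearMap]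
    exact (lTensorHomEquivHomLTensor R X S M).bijective
  exact (LinearEquiv.bijective (ModuleCat.homLinearEquiv (S := R) (M := X)
    (N := (TT R S).obj M)).symm).comp (e.comp
    (LinearEquiv.lTensor S (ModuleCat.homLinearEquiv (S := R) (M := X) (N := M))).bijective)

abbrev GG (M : ModuleCat.{u} R) : ModuleCat.{u} R ⥤ (ModuleCat.{u} R)ᵒᵖ :=
  ((linearYoneda R (ModuleCat R)).obj M).rightOp

noncomputable def alpha (M : ModuleCat.{u} R) {N : ModuleCat.{u} R} (g : M ⟶ N) : GG R N ⟶ GG R M :=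
  NatTrans.rightOp ((linearYoneda R (ModuleCat R)).map g)

noncomputable def beta (M : ModuleCat.{u} R) : GG R ((TT R S).obj M) ⟶ GG R M ⋙ (TT R S).op where
  app X := (ModuleCat.ofHom (betaApp R S M X)).op
  naturality X Y g := by
    apply Quiver.Hom.unop_inj
    apply ModuleCat.hom_ext
    apply TensorProduct.ext'
    intro s h
    rfl

theorem beta_iso (M X : ModuleCat.{u} R) [Projective X] [Module.Finite R X] :
    IsIso ((beta R S M).app X) := by
  have : IsIso (ModuleCat.ofHom (betaApp R S M X)) := by
    rw [ConcreteCategory.isIso_iff_bijective]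
    exact betaApp_bij R S M X
  exact isIso_op (ModuleCat.ofHom (betaApp R S M X))

noncomputable def tau : (TT R S).op ⟶ 𝟭 (ModuleCat.{u} R)ᵒᵖ where
  app X := ((eta R S).app X.unop).op
  naturality X Y g := by
    apply Quiver.Hom.unop_inj
    exact ((eta R S).naturality g.unop).symm

theorem beta_tau (M X : ModuleCat.{u} R) : (alpha R M ((eta R S).app M)).app X =
    (beta R S M).app X ≫ (tau R S).app ((GG R M).obj X) := by
  apply Quiver.Hom.unop_inj
  apply ModuleCat.hom_ext
  apply LinearMap.ext
  intro h
  rfl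

def scal (r : R) : 𝟭 (ModuleCat.{u} R) ⟶ 𝟭 (ModuleCat.{u} R) where
  app X := r • 𝟙 X

def scalOp (r : R) : 𝟭 (ModuleCat.{u} R)ᵒᵖ ⟶ 𝟭 (ModuleCat.{u} R)ᵒᵖ where
  app X := ((scal R r).app X.unop).op
  naturality X Y g := by
    apply Quiver.Hom.unop_inj
    exact ((scal R r).naturality g.unop).symm

instance GGadd (M : ModuleCat.{u} R) : (GG R M).Additive := inferInstance

theorem smul_id_comp' {M Y : ModuleCat.{u} R} (r : R) (h : Y ⟶ M) : (r • 𝟙 Y) ≫ h = r • h := by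
  rw [Linear.smul_comp, Category.id_comp]

/-- `Ext` is killed by scalars killing the first argument. -/
theorem ext_killed (M X : ModuleCat.{u} R) (n : ℕ) (r : R) (hr : ∀ x : X, r • x = 0)
    (y : (((GG R M).leftDerived n).obj X).unop) : r • y = 0 := by
  have h := leftDerived_scalar (GG R M) (scalOp R r) (scal R r) (by
    intro Y
    apply Quiver.Hom.unop_inj
    apply ModuleCat.hom_ext
    apply LinearMap.ext
    intro h
    exact smul_id_comp' R r h) n X (by
    apply ModuleCat.hom_ext
    apply LinearMap.ext
    intro x
    exact hr x)
  have h2 := congrArg Quiver.Hom.unop h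
  exact congrArg (fun g => g.hom y) h2

theorem isIso_ext [IsNoetherianRing R] [Module.Flat R S] (M : ModuleCat.{u} R) (X : Type u) [AddCommGroup X]
    [Module R X] [Module.Finite R X] (n : ℕ)
    (h : Function.Bijective (TensorProduct.mk R S (((GG R M).leftDerived n).obj (ModuleCat.of R X)).unop 1)) :
    IsIso ((NatTrans.leftDerived (alpha R M ((eta R S).app M)) n).app (ModuleCat.of R X)) := by
  obtain ⟨P, hP⟩ := fg_resolution (R := R) X
  have := op_preservesHomology (TT R S)
  refine isIso_leftDerived_app (alpha R M ((eta R S).app M)) (TT R S).op (tau R S) (beta R S M)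
    (beta_tau R S M) P (fun i => ?_) n ?_
  · have := hP i
    have := P.projective i
    exact beta_iso R S M _
  · have : IsIso ((eta R S).app (((GG R M).leftDerived n).obj (ModuleCat.of R X)).unop) := by
      rw [ConcreteCategory.isIso_iff_bijective]
      exact h
    exact isIso_op ((eta R S).app (((GG R M).leftDerived n).obj (ModuleCat.of R X)).unop)
end tens
end LCaux

namespace LCaux
section compl
variable {R : Type u} [CommRing R] [IsNoetherianRing R] (I : Ideal R)

theorem compl_bij (t : ℕ) (H : Type u) [AddCommGroup H] [Module R H]
    (hH : ∀ r ∈ I ^ t, ∀ y : H, r • y = 0) :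
    Function.Bijective (TensorProduct.mk R (AdicCompletion I R) H 1) := by
  have hJ : (I ^ t • ⊤ : Submodule R R) = I ^ t := by simp
  let e := AdicCompletion.eval I R t
  let l : (R ⧸ (I ^ t • ⊤ : Submodule R R)) →ₗ[R] H →ₗ[R] H :=
    Submodule.liftQ _ (LinearMap.lsmul R H) (by
      rw [hJ]
      intro r hr
      ext y
      exact hH r hr y)
  let L : AdicCompletion I R ⊗[R] H →ₗ[R] H := TensorProduct.lift (l ∘ₗ e)
  constructor
  · apply Function.LeftInverse.injective (g := L)
    intro y
    change l (e 1) y = y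
    have : e 1 = Submodule.Quotient.mk 1 := rfl
    rw [this]
    exact one_smul R y
  · rw [← LinearMap.range_eq_top, eq_top_iff]
    rintro x -
    induction x using TensorProduct.induction_on with
    | zero => exact zero_mem _
    | add x y hx hy => exact add_mem hx hy
    | tmul s y =>
      obtain ⟨r, hr⟩ := Submodule.Quotient.mk_surjective _ (e s)
      refine ⟨r • y, ?_⟩
      have h1 : s - r • (1 : AdicCompletion I R) ∈ (e.ker) := by
        rw [LinearMap.mem_ker, map_sub, map_smul, ← hr, sub_eq_zero]
        have : e 1 = Submodule.Quotient.mk 1 := rfl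
        rw [this, ← Submodule.Quotient.mk_smul]
        simp
      rw [← AdicCompletion.pow_smul_top_eq_ker_eval (IsNoetherian.noetherian I)] at h1
      have h2 : ∀ z ∈ (I ^ t • ⊤ : Submodule R (AdicCompletion I R)), z ⊗ₜ[R] y = 0 := by
        intro z hz
        refine Submodule.smul_induction_on hz ?_ ?_
        · intro a ha s _
          rw [TensorProduct.smul_tmul, hH a ha, tmul_zero]
        · intro a b ha hb
          rw [add_tmul, ha, hb, add_zero]
      have h3 := h2 _ h1
      rw [sub_tmul, sub_eq_zero] at h3
      rw [h3, TensorProduct.mk_apply, TensorProduct.smul_tmul]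

theorem isIso_ext_compl (M : ModuleCat.{u} R) (t n : ℕ) :
    IsIso ((NatTrans.leftDerived (alpha R M ((eta R (AdicCompletion I R)).app M)) n).app
      (ModuleCat.of R (R ⧸ I ^ t))) := by
  have : Module.Flat R (AdicCompletion I R) := AdicCompletion.flat_of_isNoetherian I
  apply isIso_ext
  apply compl_bij I t
  intro r hr y
  apply ext_killed
  intro x
  obtain ⟨x, rfl⟩ := Ideal.Quotient.mk_surjective x
  exact Ideal.Quotient.eq_zero_iff_mem.2 (Ideal.mul_mem_right x _ hr)
end compl
end LCaux

namespace LCaux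
section asm
variable {R : Type u} [CommRing R]

noncomputable abbrev RM (m : Ideal R) : ℕᵒᵖ ⥤ ModuleCat.{u} R :=
  localCohomology.ringModIdeals (localCohomology.idealPowersDiagram m)

noncomputable abbrev KK (m : Ideal R) (M : ModuleCat.{u} R) (n : ℕ) : (ℕᵒᵖ)ᵒᵖ ⥤ ModuleCat.{u} R :=
  (RM m).op ⋙ ((GG R M).leftDerived n).leftOp

noncomputable def lcIso (m : Ideal R) (M : ModuleCat.{u} R) (n : ℕ) :
    (localCohomology m n).obj M ≅ colimit (KK m M n) :=
  colimitObjIsoColimitCompEvaluation (localCohomology.diagram (localCohomology.idealPowersDiagram m) n) M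

noncomputable def rmIso {S : Type u} [CommRing S] (f : R →+* S) (m : Ideal R) :
    RM m ⋙ ModuleCat.extendScalars f ≅ RM (m.map f) :=
  NatIso.ofComponents (fun t => qIso f (J := m ^ t.unop) (K := m.map f ^ t.unop) (Ideal.map_pow f m _).symm)
    (fun g => qIso_nat f _ _ (Ideal.pow_le_pow_right g.unop.le) (Ideal.pow_le_pow_right g.unop.le))

def leftOpIso {C D : Type*} [Category* C] [Category* D] {F G : C ⥤ Dᵒᵖ} (e : F ≅ G) :
    G.leftOp ≅ F.leftOp where
  hom := NatTrans.leftOp e.hom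
  inv := NatTrans.leftOp e.inv
  hom_inv_id := by
    ext X
    exact congrArg (fun a => (a.app X.unop).unop) e.inv_hom_id
  inv_hom_id := by
    ext X
    exact congrArg (fun a => (a.app X.unop).unop) e.hom_inv_id

def rightOpIso {C D : Type*} [Category* C] [Category* D] {F G : Cᵒᵖ ⥤ D} (e : F ≅ G) :
    G.rightOp ≅ F.rightOp where
  hom := NatTrans.rightOp e.hom
  inv := NatTrans.rightOp e.inv
  hom_inv_id := by
    ext X
    exact congrArg (fun a => (a.app (op X)).op) e.inv_hom_id
  inv_hom_id := by
    ext X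
    exact congrArg (fun a => (a.app (op X)).op) e.hom_inv_id

/-- A linear equivalence between objects of the category of modules is an isomorphism. -/
def linIso {X Y : ModuleCat.{u} R} (e : X ≃ₗ[R] Y) : X ≅ Y where
  hom := ModuleCat.ofHom e.toLinearMap
  inv := ModuleCat.ofHom e.symm.toLinearMap

noncomputable def kIso1 {S : Type u} [CommRing S] (f : R →+* S) (hf : f.Flat) (m : Ideal R)
    (N : ModuleCat.{u} S) (n : ℕ) :
    KK m ((ModuleCat.restrictScalars f).obj N) n ≅ KK (m.map f) N n ⋙ ModuleCat.restrictScalars f :=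
  Functor.isoWhiskerLeft (RM m).op (leftOpIso (extBC f hf N n)) ≪≫
    (Functor.isoWhiskerRight (NatIso.op (rmIso f m).symm)
      (((GG S N).leftDerived n).leftOp ⋙ ModuleCat.restrictScalars f))

noncomputable def kIso2 (m : Ideal R) {M M' : ModuleCat.{u} R} (e : M ≅ M') (n : ℕ) :
    KK m M n ≅ KK m M' n :=
  Functor.isoWhiskerLeft (RM m).op (leftOpIso
    (derivedCongr (rightOpIso ((linearYoneda R (ModuleCat R)).mapIso e)) n))

noncomputable def kHom3 (m : Ideal R) [IsNoetherianRing R] (M : ModuleCat.{u} R) (n : ℕ) :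
    KK m M n ⟶ KK m ((TT R (AdicCompletion m R)).obj M) n :=
  Functor.whiskerLeft (RM m).op (NatTrans.leftOp
    (NatTrans.leftDerived (alpha R M ((eta R (AdicCompletion m R)).app M)) n))

theorem kHom3_iso (m : Ideal R) [IsNoetherianRing R] (M : ModuleCat.{u} R) (n : ℕ) :
    IsIso (kHom3 m M n) := by
  have : ∀ t, IsIso ((kHom3 m M n).app t) := by
    intro t
    have := isIso_ext_compl m M t.unop.unop n
    exact isIso_unop ((NatTrans.leftDerived (alpha R M ((eta R (AdicCompletion m R)).app M)) n).app
      (ModuleCat.of R (R ⧸ m ^ t.unop.unop)))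
  exact NatIso.isIso_of_isIso_app _

theorem base_smul (S : Type u) [CommRing S] [Algebra R S] (M : Type u) [AddCommGroup M] [Module R M]
    (r : R) (x : S ⊗[R] M) : r • x = algebraMap R S r • x := (algebraMap_smul S r x).symm

noncomputable def baseIso (S : Type u) [CommRing S] [Algebra R S] (M : Type u) [AddCommGroup M] [Module R M] :
    (TT R S).obj (ModuleCat.of R M) ≅ (ModuleCat.restrictScalars (algebraMap R S)).obj
      (ModuleCat.of S (S ⊗[R] M)) :=
  linIso (X := (TT R S).obj (ModuleCat.of R M)) (Y := (ModuleCat.restrictScalars (algebraMap R S)).obj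
      (ModuleCat.of S (S ⊗[R] M)))
    { AddEquiv.refl (S ⊗[R] M) with
      map_smul' := fun r x => base_smul S M r x }

theorem main {R : Type u} [CommRing R] [IsNoetherianRing R] (m : Ideal R)
    (M : Type u) [AddCommGroup M] [Module R M] (j : ℕ) :
    Nonempty ((localCohomology m j).obj (ModuleCat.of R M) ≅
      (ModuleCat.restrictScalars (algebraMap R (AdicCompletion m R))).obj
        ((localCohomology (m.map (algebraMap R (AdicCompletion m R))) j).obj
          (ModuleCat.of (AdicCompletion m R) (AdicCompletion m R ⊗[R] M)))) := by
  have hflat : Module.Flat R (AdicCompletion m R) := AdicCompletion.flat_of_isNoetherian m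
  have hf : (algebraMap R (AdicCompletion m R)).Flat := (RingHom.flat_algebraMap_iff).2 hflat
  have := kHom3_iso m (ModuleCat.of R M) j
  let N := ModuleCat.of (AdicCompletion m R) (AdicCompletion m R ⊗[R] M)
  let e : KK m (ModuleCat.of R M) j ≅ KK (m.map (algebraMap R (AdicCompletion m R))) N j ⋙
      ModuleCat.restrictScalars (algebraMap R (AdicCompletion m R)) :=
    asIso (kHom3 m (ModuleCat.of R M) j) ≪≫ kIso2 m (baseIso (AdicCompletion m R) M) j ≪≫
      kIso1 _ hf m N j
  exact ⟨lcIso m (ModuleCat.of R M) j ≪≫ HasColimit.isoOfNatIso e ≪≫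
    (preservesColimitIso (ModuleCat.restrictScalars (algebraMap R (AdicCompletion m R)))
      (KK (m.map (algebraMap R (AdicCompletion m R))) N j)).symm ≪≫
    (ModuleCat.restrictScalars (algebraMap R (AdicCompletion m R))).mapIso (lcIso _ N j).symm⟩
end asm
end LCaux

end helpers

/-- Let `R` be a Noetherian commutative ring, `m ⊆ R` a maximal ideal and
`M` an `R`-module. Then for all `j`, the local cohomology `H^j_m(M)` is canonically
isomorphic (as an `R`-module) to `H^j_{m R^∧}(M ⊗_R R^∧)`, where `R^∧` is the `m`-adic
completion of `R` (insensitivity of local cohomology to completion at a maximal ideal). -/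
theorem localCohomology_insensitive_to_completion
    {R : Type u} [CommRing R] [IsNoetherianRing R] (m : Ideal R) (hm : m.IsMaximal)
    (M : Type u) [AddCommGroup M] [Module R M] (j : ℕ) :
    Nonempty ((localCohomology m j).obj (ModuleCat.of R M) ≅
      (ModuleCat.restrictScalars (algebraMap R (AdicCompletion m R))).obj
        ((localCohomology (m.map (algebraMap R (AdicCompletion m R))) j).obj
          (ModuleCat.of (AdicCompletion m R) (AdicCompletion m R ⊗[R] M)))) := by
  exact LCaux.main m M j
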